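/- arXiv:1908.06825 — 2 statements merged into one kernel-verified Lean document; each statement's English description precedes it below -/
import Mathlib

section
/- Let ψ be the Lévy–Khintchine exponent of a triplet (a,Q,μ) on ℝ^n in which the symmetric positive semidefinite matrix Q is non-degenerate (positive definite, i.e. of full rank). Then ψ satisfies the Kanda–Forst condition: there exists a constant M > 0 such that |Im ψ(z)| ≤ M·(1 + Re ψ(z)) for all z ∈ ℝ^n. -/
open MeasureTheory Matrix Complex

/-- The Euclidean norm of a vector `x : ι → ℝ`. -/
noncomputable def eNorm {ι : Type*} [Fintype ι] (x : ι → ℝ) : ℝ := Real.sqrt (x ⬝ᵥ x)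

/-- The integrand `1 - e^{i⟨z,x⟩} + i⟨z,x⟩·1_{|x|<1}` in the Lévy–Khintchine formula. -/
noncomputable def levyIntegrand {ι : Type*} [Fintype ι] (z x : ι → ℝ) : ℂ :=
  1 - Complex.exp (Complex.I * ((z ⬝ᵥ x : ℝ) : ℂ)) +
    Complex.I * ((z ⬝ᵥ x : ℝ) : ℂ) * (if eNorm x < 1 then 1 else 0)

/-- `μ` is a Lévy measure: `μ({0}) = 0` and `∫ min(1,|x|²) dμ < ∞`. -/
def IsLevyMeasure {ι : Type*} [Fintype ι] (μ : Measure (ι → ℝ)) : Prop :=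
  μ {0} = 0 ∧ ∫⁻ x, ENNReal.ofReal (min 1 (eNorm x ^ 2)) ∂μ < ⊤

/-- The Lévy–Khintchine exponent of the triplet `(a, Q, μ)`:
`ψ(z) = i⟨a,z⟩ + (1/2)⟨z,Qz⟩ + ∫ (1 - e^{i⟨z,x⟩} + i⟨z,x⟩·1_{|x|<1}) dμ(x)`. -/
noncomputable def levyExp {ι : Type*} [Fintype ι] (a : ι → ℝ) (Q : Matrix ι ι ℝ)
    (μ : Measure (ι → ℝ)) (z : ι → ℝ) : ℂ :=
  Complex.I * ((a ⬝ᵥ z : ℝ) : ℂ) + ((1 : ℂ)/2) * ((z ⬝ᵥ Q.mulVec z : ℝ) : ℂ) +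
    ∫ x, levyIntegrand z x ∂μ

lemma Complex.norm_one_sub_exp_I_mul_ofReal_add_le (t : ℝ) :
    ‖1 - Complex.exp (Complex.I * (t : ℂ)) + Complex.I * (t : ℂ)‖ ≤ 3 * t ^ 2 := by
  have hI : ‖Complex.I * (t : ℂ)‖ = |t| := by simp
  rcases le_total |t| 1 with h | h
  · have h1 := Complex.norm_exp_sub_one_sub_id_le (x := Complex.I * (t : ℂ)) (by rw [hI]; exact h)
    rw [hI, sq_abs] at h1
    rw [← norm_neg]
    have h2 : -(1 - Complex.exp (Complex.I * (t : ℂ)) + Complex.I * (t : ℂ)) =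
        Complex.exp (Complex.I * (t : ℂ)) - 1 - Complex.I * (t : ℂ) := by ring
    rw [h2]
    nlinarith [sq_nonneg t]
  · have h1 : ‖Complex.exp (Complex.I * (t : ℂ))‖ = 1 := by
      rw [mul_comm]; exact Complex.norm_exp_ofReal_mul_I t
    calc ‖1 - Complex.exp (Complex.I * (t : ℂ)) + Complex.I * (t : ℂ)‖
        ≤ ‖(1 : ℂ)‖ + ‖Complex.exp (Complex.I * (t : ℂ))‖ + ‖Complex.I * (t : ℂ)‖ :=
          (norm_add_le _ _).trans (by gcongr; exact norm_sub_le _ _)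
      _ = 2 + |t| := by rw [h1, hI, norm_one]; norm_num
      _ ≤ 3 * t ^ 2 := by rw [← sq_abs]; nlinarith

section

variable {ι : Type*} [Fintype ι]

lemma dotProduct_self_nonneg_real (x : ι → ℝ) : 0 ≤ x ⬝ᵥ x :=
  Finset.sum_nonneg fun i _ => mul_self_nonneg (x i)

lemma eNorm_sq (x : ι → ℝ) : eNorm x ^ 2 = x ⬝ᵥ x :=
  Real.sq_sqrt (dotProduct_self_nonneg_real x)

lemma dotProduct_sq_le (x y : ι → ℝ) : (x ⬝ᵥ y) ^ 2 ≤ (x ⬝ᵥ x) * (y ⬝ᵥ y) := by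
  simpa only [dotProduct, ← pow_two] using Finset.sum_mul_sq_le_sq_mul_sq Finset.univ x y

lemma continuous_eNorm : Continuous (eNorm : (ι → ℝ) → ℝ) :=
  Real.continuous_sqrt.comp (continuous_id.dotProduct continuous_id)

lemma norm_levyIntegrand_le (z x : ι → ℝ) :
    ‖levyIntegrand z x‖ ≤ 3 * (1 + z ⬝ᵥ z) * min 1 (eNorm x ^ 2) := by
  have hz := dotProduct_self_nonneg_real z
  have hx := dotProduct_self_nonneg_real x
  have hx0 : 0 ≤ eNorm x := Real.sqrt_nonneg _
  unfold levyIntegrand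
  split_ifs with h
  · rw [min_eq_right (by nlinarith), mul_one, eNorm_sq]
    refine (Complex.norm_one_sub_exp_I_mul_ofReal_add_le _).trans ?_
    nlinarith [dotProduct_sq_le z x]
  · rw [min_eq_left (by nlinarith), mul_zero, add_zero]
    have h1 : ‖Complex.exp (Complex.I * ((z ⬝ᵥ x : ℝ) : ℂ))‖ = 1 := by
      rw [mul_comm]; exact Complex.norm_exp_ofReal_mul_I _
    have h2 := norm_sub_le (1 : ℂ) (Complex.exp (Complex.I * ((z ⬝ᵥ x : ℝ) : ℂ)))
    rw [h1, norm_one] at h2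
    linarith

lemma levyIntegrand_re (z x : ι → ℝ) : (levyIntegrand z x).re = 1 - Real.cos (z ⬝ᵥ x) := by
  unfold levyIntegrand
  rw [mul_comm Complex.I]
  split_ifs <;> simp [Complex.exp_ofReal_mul_I_re]

lemma integral_levyIntegrand_re_nonneg (μ : Measure (ι → ℝ)) (z : ι → ℝ) :
    0 ≤ (∫ x, levyIntegrand z x ∂μ).re := by
  by_cases h : Integrable (levyIntegrand z) μ
  · have h1 : ∫ x, (levyIntegrand z x).re ∂μ = (∫ x, levyIntegrand z x ∂μ).re := integral_re h
    rw [← h1]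
    refine integral_nonneg fun x => ?_
    simp only [levyIntegrand_re, Pi.zero_apply]
    linarith [Real.cos_le_one (z ⬝ᵥ x)]
  · rw [integral_undef h, Complex.zero_re]

lemma IsLevyMeasure.integrable {μ : Measure (ι → ℝ)} (hμ : IsLevyMeasure μ) :
    Integrable (fun x => min 1 (eNorm x ^ 2)) μ := by
  refine ⟨(continuous_const.min (continuous_eNorm.pow 2)).aestronglyMeasurable, ?_⟩
  rw [hasFiniteIntegral_iff_ofReal (Filter.Eventually.of_forall fun x => by positivity)]
  exact hμ.2

lemma IsLevyMeasure.norm_integral_levyIntegrand_le {μ : Measure (ι → ℝ)} (hμ : IsLevyMeasure μ)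
    (z : ι → ℝ) :
    ‖∫ x, levyIntegrand z x ∂μ‖ ≤ 3 * (1 + z ⬝ᵥ z) * ∫ x, min 1 (eNorm x ^ 2) ∂μ := by
  rw [← integral_const_mul]
  exact norm_integral_le_of_norm_le (hμ.integrable.const_mul _)
    (Filter.Eventually.of_forall (norm_levyIntegrand_le z))

lemma isCompact_dotProduct_self_eq_one : IsCompact {z : ι → ℝ | z ⬝ᵥ z = 1} := by
  refine (isCompact_closedBall (0 : ι → ℝ) 1).of_isClosed_subset
    (isClosed_eq (continuous_id.dotProduct continuous_id) continuous_const) fun z hz => ?_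
  rw [mem_closedBall_zero_iff, pi_norm_le_iff_of_nonneg zero_le_one]
  intro i
  have h : z i * z i ≤ z ⬝ᵥ z :=
    Finset.single_le_sum (f := fun i => z i * z i) (fun j _ => mul_self_nonneg (z j))
      (Finset.mem_univ i)
  rw [Set.mem_ofPred_eq.mp hz] at h
  rw [Real.norm_eq_abs, ← sq_le_one_iff_abs_le_one, pow_two]
  exact h

lemma Matrix.PosDef.exists_mul_dotProduct_self_le {Q : Matrix ι ι ℝ} (hQ : Q.PosDef) :
    ∃ c > (0 : ℝ), ∀ z : ι → ℝ, c * (z ⬝ᵥ z) ≤ z ⬝ᵥ Q.mulVec z := by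
  obtain ⟨c, hc, h⟩ := isCompact_dotProduct_self_eq_one.exists_forall_le' (a := (0 : ℝ))
    (f := fun z : ι → ℝ => z ⬝ᵥ Q.mulVec z)
    (continuous_id.dotProduct (continuous_const.matrix_mulVec continuous_id)).continuousOn
    fun z hz => by
      have hz0 : z ≠ 0 := by
        rintro rfl
        simp at hz
      simpa using hQ.dotProduct_mulVec_pos hz0
  refine ⟨c, hc, fun z => ?_⟩
  rcases (dotProduct_self_nonneg_real z).eq_or_lt with h0 | h0
  · rw [dotProduct_self_eq_zero.mp h0.symm]
    simp
  · have hr : 0 < eNorm z := Real.sqrt_pos.mpr h0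
    have h1 := h ((eNorm z)⁻¹ • z) (by
      rw [Set.mem_ofPred_eq, smul_dotProduct, dotProduct_smul, smul_eq_mul, smul_eq_mul, ← eNorm_sq]
      field_simp)
    simp only [mulVec_smul, smul_dotProduct, dotProduct_smul, smul_eq_mul] at h1
    rw [← eNorm_sq]
    calc c * eNorm z ^ 2
        ≤ ((eNorm z)⁻¹ * ((eNorm z)⁻¹ * (z ⬝ᵥ Q.mulVec z))) * eNorm z ^ 2 := by gcongr
      _ = z ⬝ᵥ Q.mulVec z := by field_simp

lemma levyExp_re (a : ι → ℝ) (Q : Matrix ι ι ℝ) (μ : Measure (ι → ℝ)) (z : ι → ℝ) :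
    (levyExp a Q μ z).re = (z ⬝ᵥ Q.mulVec z) / 2 + (∫ x, levyIntegrand z x ∂μ).re := by
  simp [levyExp]
  ring

lemma levyExp_im (a : ι → ℝ) (Q : Matrix ι ι ℝ) (μ : Measure (ι → ℝ)) (z : ι → ℝ) :
    (levyExp a Q μ z).im = a ⬝ᵥ z + (∫ x, levyIntegrand z x ∂μ).im := by
  simp [levyExp]

lemma abs_dotProduct_le (a z : ι → ℝ) : |a ⬝ᵥ z| ≤ a ⬝ᵥ a + z ⬝ᵥ z := by
  have ha := dotProduct_self_nonneg_real a
  have hz := dotProduct_self_nonneg_real z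
  refine abs_le_of_sq_le_sq ?_ (by positivity)
  nlinarith [dotProduct_sq_le a z]

end

theorem stmt2 {n : ℕ} (a : Fin n → ℝ) (Q : Matrix (Fin n) (Fin n) ℝ) (hQ : Q.PosDef)
    (μ : Measure (Fin n → ℝ)) (hμ : IsLevyMeasure μ) :
    ∃ M > (0 : ℝ), ∀ z : Fin n → ℝ,
      |(levyExp a Q μ z).im| ≤ M * (1 + (levyExp a Q μ z).re) := by
  obtain ⟨c, hc, hQc⟩ := hQ.exists_mul_dotProduct_self_le
  have hK : 0 ≤ ∫ x, min 1 (eNorm x ^ 2) ∂μ := integral_nonneg fun x => by positivity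
  set K := ∫ x, min 1 (eNorm x ^ 2) ∂μ
  have ha := dotProduct_self_nonneg_real a
  refine ⟨(a ⬝ᵥ a + 1 + 3 * K) * (1 + 2 / c), by positivity, fun z => ?_⟩
  have hz := dotProduct_self_nonneg_real z
  have hre : c * (z ⬝ᵥ z) / 2 ≤ (levyExp a Q μ z).re := by
    rw [levyExp_re]
    linarith [hQc z, integral_levyIntegrand_re_nonneg μ z]
  have hsq : 1 + z ⬝ᵥ z ≤ (1 + 2 / c) * (1 + (levyExp a Q μ z).re) := by
    calc 1 + z ⬝ᵥ z ≤ 1 + z ⬝ᵥ z + (2 / c + c * (z ⬝ᵥ z) / 2) :=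
          le_add_of_nonneg_right (by positivity)
      _ = (1 + 2 / c) * (1 + c * (z ⬝ᵥ z) / 2) := by field_simp; ring
      _ ≤ _ := by gcongr
  calc |(levyExp a Q μ z).im| ≤ |a ⬝ᵥ z| + |(∫ x, levyIntegrand z x ∂μ).im| := by
        rw [levyExp_im]; exact abs_add_le _ _
    _ ≤ (a ⬝ᵥ a + z ⬝ᵥ z) + 3 * (1 + z ⬝ᵥ z) * K :=
        add_le_add (abs_dotProduct_le a z)
          ((Complex.abs_im_le_norm _).trans (hμ.norm_integral_levyIntegrand_le z))
    _ ≤ (a ⬝ᵥ a + 1 + 3 * K) * (1 + z ⬝ᵥ z) := by nlinarith [mul_nonneg ha hz]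
    _ ≤ (a ⬝ᵥ a + 1 + 3 * K) * (1 + 2 / c) * (1 + (levyExp a Q μ z).re) := by
        rw [mul_assoc]; gcongr
end

section
/- For all real numbers λ > 0, p ≥ 0, r ≥ 0 and q, s ∈ ℝ, one has (λ+p+r)/((λ+p+r)² + (q+s)²) ≥ [1/(2(1 + (r²+s²)/λ²))] · (λ+p)/((λ+p)² + q²). -/
theorem stmt10 (lam p r q s : ℝ) (hlam : 0 < lam) (hp : 0 ≤ p) (hr : 0 ≤ r) :
    1 / (2 * (1 + (r ^ 2 + s ^ 2) / lam ^ 2)) *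
        ((lam + p) / ((lam + p) ^ 2 + q ^ 2)) ≤
      (lam + p + r) / ((lam + p + r) ^ 2 + (q + s) ^ 2) := by
  have hK : 0 ≤ (r ^ 2 + s ^ 2) / lam ^ 2 := by positivity
  have hKlam : (r ^ 2 + s ^ 2) / lam ^ 2 * lam ^ 2 = r ^ 2 + s ^ 2 := by field_simp
  have hZ : lam ^ 2 ≤ (lam + p) ^ 2 + q ^ 2 := by nlinarith [sq_nonneg q, mul_nonneg hlam.le hp]
  rw [div_mul_div_comm, one_mul]
  have hKZ := mul_le_mul_of_nonneg_left hZ hK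
  refine div_le_div₀ (by positivity) (by linarith) (by positivity) ?_
  linarith [sq_nonneg (lam + p - r), sq_nonneg (q - s)]
end
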